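/- Let P̃ ∈ ℝⁿ and, for ν ∈ ℝⁿ, let M(ν) be the (n+1)×(n+1) block matrix with top-left n×n block [ν] Y_LL + Y_LL [ν], top-right n×1 block [ν] I_L^*, bottom-left 1×n block ([ν] I_L^*)ᵀ, and bottom-right 1×1 entry 2 νᵀ P̃. Then P̃ ∈ F if and only if there exists no ν ∈ ℝⁿ with all entries positive such that M(ν) is positive definite. Moreover, P̃ belongs to the topological interior of F if and only if there exists no ν ∈ ℝⁿ with all entries positive such that M(ν) is positive semidefinite. -/

import Mathlib

open Matrix Set

noncomputable section

/-- `A` is irreducible: for every nonempty proper subset `α` of the index set,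
the submatrix `A[α, αᶜ]` is not the zero matrix. -/
def IsIrred {k : ℕ} (A : Matrix (Fin k) (Fin k) ℝ) : Prop :=
  ∀ α : Finset (Fin k), α.Nonempty → α ≠ Finset.univ → ∃ i ∈ α, ∃ j ∈ αᶜ, A i j ≠ 0

/-- `A` is a Z-matrix: off-diagonal entries are nonpositive. -/
def IsZmat {k : ℕ} (A : Matrix (Fin k) (Fin k) ℝ) : Prop :=
  ∀ i j, i ≠ j → A i j ≤ 0

/-- `A` is an M-matrix: a Z-matrix all of whose eigenvalues have nonnegative real part. -/
def IsMmat {k : ℕ} (A : Matrix (Fin k) (Fin k) ℝ) : Prop :=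
  IsZmat A ∧ ∀ μ ∈ spectrum ℂ (A.map (Complex.ofReal)), 0 ≤ μ.re

/-- `A` is a nonsingular M-matrix: a Z-matrix all of whose eigenvalues have positive real part. -/
def IsNonsingMmat {k : ℕ} (A : Matrix (Fin k) (Fin k) ℝ) : Prop :=
  IsZmat A ∧ ∀ μ ∈ spectrum ℂ (A.map (Complex.ofReal)), 0 < μ.re

/-- `P_c(x) = [x] Y (V* − x)`. -/
def Pc {k : ℕ} (Y : Matrix (Fin k) (Fin k) ℝ) (Vs : Fin k → ℝ) (x : Fin k → ℝ) : Fin k → ℝ :=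
  Matrix.diagonal x *ᵥ (Y *ᵥ (Vs - x))

/-- Jacobian of `P_c` at `x`: `J(x) = [Y(V* − x)] − [x] Y`. -/
def Jmat {k : ℕ} (Y : Matrix (Fin k) (Fin k) ℝ) (Vs : Fin k → ℝ) (x : Fin k → ℝ) :
    Matrix (Fin k) (Fin k) ℝ :=
  Matrix.diagonal (Y *ᵥ (Vs - x)) - Matrix.diagonal x * Y

/-- long-term voltage stable operating points. -/
def Dset {k : ℕ} (Y : Matrix (Fin k) (Fin k) ℝ) (Vs : Fin k → ℝ) : Set (Fin k → ℝ) :=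
  {x | (∀ i, 0 < x i) ∧ IsUnit (Jmat Y Vs x).det ∧ ∀ i j, (Jmat Y Vs x)⁻¹ i j < 0}

/-- feasible power demands. -/
def Fset {k : ℕ} (Y : Matrix (Fin k) (Fin k) ℝ) (Vs : Fin k → ℝ) : Set (Fin k → ℝ) :=
  {P | ∃ x, (∀ i, 0 < x i) ∧ Pc Y Vs x = P}

/-- `h(λ) = (1/2)([λ] Y + Y [λ])`. -/
def hmat {k : ℕ} (Y : Matrix (Fin k) (Fin k) ℝ) (l : Fin k → ℝ) : Matrix (Fin k) (Fin k) ℝ :=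
  (1/2 : ℝ) • (Matrix.diagonal l * Y + Y * Matrix.diagonal l)

/-- `Λ₁ = {λ ∈ Λ : λ > 0, 1ᵀλ = 1}`. -/
def Lam1 {k : ℕ} (Y : Matrix (Fin k) (Fin k) ℝ) : Set (Fin k → ℝ) :=
  {l | (hmat Y l).PosDef ∧ (∀ i, 0 < l i) ∧ ∑ i, l i = 1}

/-- `φ(λ) = (1/2) h(λ)⁻¹ [λ] I*` where `I* = Y V*`. -/
def phiv {k : ℕ} (Y : Matrix (Fin k) (Fin k) ℝ) (Vs : Fin k → ℝ) (l : Fin k → ℝ) : Fin k → ℝ :=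
  (1/2 : ℝ) • ((hmat Y l)⁻¹ *ᵥ (Matrix.diagonal l *ᵥ (Y *ᵥ Vs)))

/-- `‖x‖_{h(λ)}²  = xᵀ h(λ) x`. -/
def qnorm {k : ℕ} (Y : Matrix (Fin k) (Fin k) ℝ) (l x : Fin k → ℝ) : ℝ :=
  x ⬝ᵥ (hmat Y l *ᵥ x)

/-- The half-space `H_λ`. -/
def Hset {k : ℕ} (Y : Matrix (Fin k) (Fin k) ℝ) (Vs : Fin k → ℝ) (l : Fin k → ℝ) :
    Set (Fin k → ℝ) :=
  {y | l ⬝ᵥ y ≤ qnorm Y l (phiv Y Vs l)}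


/-- The `(n+1)×(n+1)` block matrix `M(ν)` of the LMI condition. -/
def Mnu {k : ℕ} (Y : Matrix (Fin k) (Fin k) ℝ) (Vs : Fin k → ℝ) (Pt : Fin k → ℝ)
    (ν : Fin k → ℝ) : Matrix (Fin k ⊕ Fin 1) (Fin k ⊕ Fin 1) ℝ :=
  Matrix.fromBlocks
    (Matrix.diagonal ν * Y + Y * Matrix.diagonal ν)
    (Matrix.of fun i (_ : Fin 1) => (Matrix.diagonal ν *ᵥ (Y *ᵥ Vs)) i)
    (Matrix.of fun (_ : Fin 1) j => (Matrix.diagonal ν *ᵥ (Y *ᵥ Vs)) j)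
    (Matrix.of fun (_ : Fin 1) (_ : Fin 1) => 2 * (ν ⬝ᵥ Pt))

/-- homogenised power-balance residual -/
def qf {n : ℕ} (Y : Matrix (Fin n) (Fin n) ℝ) (I P x : Fin n → ℝ) (t : ℝ) (i : Fin n) : ℝ :=
  ∑ j, Y i j * (x i * x j) + t * (I i * x i) + t ^ 2 * P i

lemma qf_Pc {n : ℕ} (Y : Matrix (Fin n) (Fin n) ℝ) (Vs P x : Fin n → ℝ) (i : Fin n) :
    qf Y (Y *ᵥ Vs) P x (-1) i = P i - Pc Y Vs x i := by
  have h : ∑ j, Y i j * (x i * x j) = x i * (Y *ᵥ x) i := by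
    simp only [Matrix.mulVec, dotProduct, Finset.mul_sum]
    exact Finset.sum_congr rfl fun j _ => by ring
  unfold qf Pc
  rw [h, Matrix.mulVec_diagonal, Matrix.mulVec_sub, Pi.sub_apply]
  ring

lemma qf_smul {n : ℕ} (Y : Matrix (Fin n) (Fin n) ℝ) (I P x : Fin n → ℝ) (t s : ℝ) (i : Fin n) :
    qf Y I P (s • x) (s * t) i = s ^ 2 * qf Y I P x t i := by
  unfold qf
  simp only [Pi.smul_apply, smul_eq_mul, mul_add, Finset.mul_sum]
  congr 1
  · congr 1
    · exact Finset.sum_congr rfl fun j _ => by ring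
    · ring
  · ring

lemma qf_cont {n : ℕ} (Y : Matrix (Fin n) (Fin n) ℝ) (I P : Fin n → ℝ) (i : Fin n) :
    Continuous fun p : (Fin n → ℝ) × ℝ => qf Y I P p.1 p.2 i := by
  unfold qf
  fun_prop

lemma pd_symm {n : ℕ} {Y : Matrix (Fin n) (Fin n) ℝ} (hPD : Y.PosDef) (i j : Fin n) :
    Y i j = Y j i := by
  have := hPD.1.apply i j
  simpa using this.symm

lemma Mnu_quad {n : ℕ} {Y : Matrix (Fin n) (Fin n) ℝ} (hPD : Y.PosDef) (Vs P ν : Fin n → ℝ)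
    (z : Fin n ⊕ Fin 1 → ℝ) :
    star z ⬝ᵥ (Mnu Y Vs P ν *ᵥ z) =
      2 * ∑ i, ν i * qf Y (Y *ᵥ Vs) P (z ∘ Sum.inl) (z (Sum.inr 0)) i := by
  have h1 : ∑ i, ∑ j, z (Sum.inl i) * (Y i j * ν j * z (Sum.inl j)) =
      ∑ i, ∑ j, z (Sum.inl i) * (ν i * Y i j * z (Sum.inl j)) := by
    rw [Finset.sum_comm]
    refine Finset.sum_congr rfl fun i _ => Finset.sum_congr rfl fun j _ => ?_
    rw [pd_symm hPD j i]; ring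
  generalize hI : Y *ᵥ Vs = I
  simp only [Mnu, Matrix.mulVec_diagonal, hI]
  simp only [qf, dotProduct, Matrix.mulVec, Fintype.sum_sum_type, Matrix.fromBlocks_apply₁₁,
    Matrix.fromBlocks_apply₁₂, Matrix.fromBlocks_apply₂₁, Matrix.fromBlocks_apply₂₂,
    Matrix.add_apply, Matrix.diagonal_mul, Matrix.mul_diagonal, Matrix.of_apply,
    Finset.univ_unique, Finset.sum_singleton, Fin.default_eq_zero, star_trivial, Function.comp,
    add_mul, mul_add, Finset.sum_add_distrib, Finset.mul_sum, Finset.sum_mul, h1]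
  simp only [← Finset.sum_add_distrib]
  refine Finset.sum_congr rfl fun i _ => ?_
  have h2 : ∑ j, 2 * (ν i * (Y i j * (z (Sum.inl i) * z (Sum.inl j)))) =
      ∑ j, (z (Sum.inl i) * (ν i * Y i j * z (Sum.inl j)) +
        z (Sum.inl i) * (ν i * Y i j * z (Sum.inl j))) :=
    Finset.sum_congr rfl fun j _ => by ring
  rw [h2]
  ring

lemma Mnu_herm {n : ℕ} {Y : Matrix (Fin n) (Fin n) ℝ} (hPD : Y.PosDef) (Vs P ν : Fin n → ℝ) :
    (Mnu Y Vs P ν).IsHermitian := by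
  ext i j
  rcases i with i | i <;> rcases j with j | j
  · simp [Mnu, Matrix.conjTranspose_apply, pd_symm hPD i j]
    ring
  all_goals simp [Mnu, Matrix.conjTranspose_apply]

lemma sum_qf {n : ℕ} {Y : Matrix (Fin n) (Fin n) ℝ} (hPD : Y.PosDef) (Vs P x : Fin n → ℝ) (t : ℝ) :
    ∑ i, qf Y (Y *ᵥ Vs) P x t i = (x + (t / 2) • Vs) ⬝ᵥ (Y *ᵥ (x + (t / 2) • Vs)) +
      t ^ 2 * (∑ i, P i - (Vs ⬝ᵥ (Y *ᵥ Vs)) / 4) := by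
  have h : ∑ i, ∑ j, Y i j * (x i * x j) = x ⬝ᵥ (Y *ᵥ x) := by
    simp only [Matrix.mulVec, dotProduct, Finset.mul_sum]
    exact Finset.sum_congr rfl fun i _ => Finset.sum_congr rfl fun j _ => by ring
  have h2 : Vs ⬝ᵥ (Y *ᵥ x) = x ⬝ᵥ (Y *ᵥ Vs) := by
    simp only [Matrix.mulVec, dotProduct, Finset.mul_sum]
    rw [Finset.sum_comm]
    refine Finset.sum_congr rfl fun i _ => Finset.sum_congr rfl fun j _ => ?_
    rw [pd_symm hPD j i]; ring
  have h3 : ∑ i, (Y *ᵥ Vs) i * x i = x ⬝ᵥ (Y *ᵥ Vs) := by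
    simp only [dotProduct]
    exact Finset.sum_congr rfl fun i _ => by ring
  simp only [qf, Finset.sum_add_distrib, ← Finset.mul_sum]
  simp only [h, h3, Matrix.mulVec_add, Matrix.mulVec_smul, dotProduct_add, add_dotProduct,
    smul_dotProduct, dotProduct_smul, smul_eq_mul, h2]
  ring

lemma coercive {n : ℕ} (hn : 1 ≤ n) {Y : Matrix (Fin n) (Fin n) ℝ} (hPD : Y.PosDef) :
    ∃ c : ℝ, 0 < c ∧ ∀ x : Fin n → ℝ, c * ‖x‖ ^ 2 ≤ x ⬝ᵥ (Y *ᵥ x) := by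
  haveI : Nonempty (Fin n) := ⟨⟨0, hn⟩⟩
  have hc : Continuous fun x : Fin n → ℝ => x ⬝ᵥ (Y *ᵥ x) := by
    unfold dotProduct Matrix.mulVec dotProduct
    fun_prop
  obtain ⟨x0, hx0, hmin⟩ := (isCompact_sphere (0 : Fin n → ℝ) 1).exists_isMinOn
    (NormedSpace.sphere_nonempty.2 zero_le_one) hc.continuousOn
  have hne : x0 ≠ 0 := by
    rintro rfl
    simp at hx0
  refine ⟨x0 ⬝ᵥ (Y *ᵥ x0), by simpa using hPD.dotProduct_mulVec_pos hne, fun x => ?_⟩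
  by_cases hx : x = 0
  · simp [hx]
  have hnx : 0 < ‖x‖ := norm_pos_iff.2 hx
  have := hmin (show ‖x‖⁻¹ • x ∈ Metric.sphere (0 : Fin n → ℝ) 1 by
    simp [norm_smul, hnx.ne'])
  simp only [Set.mem_setOf_eq, Matrix.mulVec_smul, smul_dotProduct, dotProduct_smul,
    smul_eq_mul] at this
  calc _ ≤ (‖x‖⁻¹ * (‖x‖⁻¹ * (x ⬝ᵥ (Y *ᵥ x)))) * ‖x‖ ^ 2 := by gcongr
    _ = _ := by field_simp

def Sset {n : ℕ} (Y : Matrix (Fin n) (Fin n) ℝ) (I P : Fin n → ℝ) : Set (Fin n → ℝ) :=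
  {x | (∀ i, 0 ≤ x i) ∧ ∀ i, qf Y I P x (-1) i ≤ 0}

lemma Sset_closed {n : ℕ} (Y : Matrix (Fin n) (Fin n) ℝ) (I P : Fin n → ℝ) :
    IsClosed (Sset Y I P) := by
  have : Sset Y I P = (⋂ i, {x | 0 ≤ x i}) ∩ ⋂ i, {x | qf Y I P x (-1) i ≤ 0} := by
    ext x; simp [Sset]
  rw [this]
  refine IsClosed.inter (isClosed_iInter fun i => isClosed_le continuous_const (continuous_apply i))
    (isClosed_iInter fun i => isClosed_le ?_ continuous_const)
  exact (qf_cont Y I P i).comp (continuous_id.prodMk continuous_const)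

lemma Sset_compact {n : ℕ} (hn : 1 ≤ n) {Y : Matrix (Fin n) (Fin n) ℝ} (hPD : Y.PosDef)
    (Vs P : Fin n → ℝ) : IsCompact (Sset Y (Y *ᵥ Vs) P) := by
  obtain ⟨c, hc, hco⟩ := coercive hn hPD
  refine Metric.isCompact_of_isClosed_isBounded (Sset_closed _ _ _) ?_
  set K := -(∑ i, P i - (Vs ⬝ᵥ (Y *ᵥ Vs)) / 4) / c
  refine (Metric.isBounded_closedBall (x := ((1/2:ℝ) • Vs)) (r := max K 1)).subset ?_
  intro x hx
  have h1 : ∑ i, qf Y (Y *ᵥ Vs) P x (-1) i ≤ 0 := Finset.sum_nonpos fun i _ => hx.2 i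
  rw [sum_qf hPD] at h1
  have h2 := hco (x + ((-1 : ℝ) / 2) • Vs)
  have h3 : x + ((-1 : ℝ) / 2) • Vs = x - (1/2:ℝ) • Vs := by
    rw [neg_div, neg_smul, sub_eq_add_neg]
  rw [h3] at h1 h2
  rw [Metric.mem_closedBall, dist_eq_norm]
  have h4 : ‖x - (1/2:ℝ) • Vs‖ ^ 2 ≤ K := by
    rw [le_div_iff₀ hc]; linarith
  by_contra! h5
  have h6 := lt_of_le_of_lt (le_max_left _ _) h5
  have h7 := lt_of_le_of_lt (le_max_right _ _) h5
  nlinarith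

lemma qf_mono {n : ℕ} {Y : Matrix (Fin n) (Fin n) ℝ} (hZ : IsZmat Y) (I P : Fin n → ℝ)
    {x y : Fin n → ℝ} (t : ℝ) (i : Fin n) (hx : 0 ≤ x i) (hxy : ∀ j, x j ≤ y j) (hi : y i = x i) :
    qf Y I P y t i ≤ qf Y I P x t i := by
  unfold qf
  rw [hi]
  gcongr 1
  gcongr 1
  refine Finset.sum_le_sum fun j _ => ?_
  by_cases h : j = i
  · subst h; rw [hi]
  · exact mul_le_mul_of_nonpos_left (mul_le_mul_of_nonneg_left (hxy j) hx) (hZ i j (Ne.symm h))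

lemma qf_bump {n : ℕ} (Y : Matrix (Fin n) (Fin n) ℝ) (I P x : Fin n → ℝ) (i : Fin n) (e : ℝ) :
    qf Y I P (Function.update x i (x i + e)) (-1) i =
      qf Y I P x (-1) i + e * ((Y *ᵥ x) i + Y i i * x i - I i + Y i i * e) := by
  have h1 : ∀ u : Fin n → ℝ, ∑ j, Y i j * (u i * u j) = u i * (Y *ᵥ u) i := by
    intro u
    simp only [Matrix.mulVec, dotProduct, Finset.mul_sum]
    exact Finset.sum_congr rfl fun j _ => by ring
  have h2 : Function.update x i (x i + e) = x + Pi.single i e := by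
    ext j
    by_cases h : j = i
    · subst h; simp
    · simp [h]
  have h3 : (Y *ᵥ (x + Pi.single i e)) i = (Y *ᵥ x) i + Y i i * e := by
    rw [Matrix.mulVec_add]; simp [mul_comm]
  unfold qf
  rw [h1, h1, h2, h3]
  simp
  ring

lemma lim_nonneg {h : ℝ → ℝ} (hc : Continuous h) (hp : ∀ e, 0 < e → 0 ≤ h e) : 0 ≤ h 0 := by
  refine ge_of_tendsto (hc.continuousWithinAt (s := Set.Ioi 0) (x := 0)) ?_
  filter_upwards [self_mem_nhdsWithin] with e he using hp e he

lemma exists_sol {n : ℕ} (hn : 1 ≤ n) {Y : Matrix (Fin n) (Fin n) ℝ} (hPD : Y.PosDef)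
    (hZ : IsZmat Y) (hirr : IsIrred Y) (Vs : Fin n → ℝ)
    (hInn : ∀ i, 0 ≤ (Y *ᵥ Vs) i) (hIne : Y *ᵥ Vs ≠ 0) (P : Fin n → ℝ)
    (hS : (Sset Y (Y *ᵥ Vs) P).Nonempty) : P ∈ Fset Y Vs := by
  obtain ⟨x, hx, hmax⟩ := (Sset_compact hn hPD Vs P).exists_isMaxOn hS
    (f := fun x => ∑ i, x i) (by fun_prop)
  have hb : ∀ i e, 0 < e → 0 < qf Y (Y *ᵥ Vs) P x (-1) i +
      e * ((Y *ᵥ x) i + Y i i * x i - (Y *ᵥ Vs) i + Y i i * e) := by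
    intro i e he
    rw [← qf_bump]
    by_contra! hle
    have hxu : ∀ j, x j ≤ Function.update x i (x i + e) j := by
      intro j
      by_cases h : j = i
      · subst h; simp [he.le]
      · simp [h]
    have hmem : Function.update x i (x i + e) ∈ Sset Y (Y *ᵥ Vs) P := by
      refine ⟨fun j => (hx.1 j).trans (hxu j), fun j => ?_⟩
      by_cases h : j = i
      · subst h; exact hle
      · exact (qf_mono hZ _ _ _ j (hx.1 j) hxu (by simp [h])).trans (hx.2 j)
    have h1 : ∑ j, Function.update x i (x i + e) j ≤ ∑ j, x j := hmax hmem
    have h2 : ∑ j, x j < ∑ j, Function.update x i (x i + e) j :=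
      Finset.sum_lt_sum (fun j _ => hxu j) ⟨i, Finset.mem_univ _, by simp [he]⟩
    linarith
  have hz : ∀ i, qf Y (Y *ᵥ Vs) P x (-1) i = 0 := by
    intro i
    refine le_antisymm (hx.2 i) ?_
    have := lim_nonneg (h := fun e => qf Y (Y *ᵥ Vs) P x (-1) i +
      e * ((Y *ᵥ x) i + Y i i * x i - (Y *ᵥ Vs) i + Y i i * e)) (by fun_prop)
      (fun e he => (hb i e he).le)
    simpa using this
  have key : ∀ i, x i = 0 → (Y *ᵥ Vs) i = 0 ∧ ∀ j, Y i j * x j = 0 := by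
    intro i hi
    have hA : 0 ≤ (Y *ᵥ x) i - (Y *ᵥ Vs) i := by
      have := lim_nonneg (h := fun e => (Y *ᵥ x) i - (Y *ᵥ Vs) i + Y i i * e) (by fun_prop)
        (fun e he => by
          have h := hb i e he
          rw [hz i, hi, zero_add] at h
          have := (pos_of_mul_pos_right h he.le).le
          simpa using this)
      simpa using this
    have hterm : ∀ j ∈ Finset.univ, Y i j * x j ≤ 0 := by
      intro j _
      by_cases h : j = i
      · subst h; simp [hi]
      · exact mul_nonpos_of_nonpos_of_nonneg (hZ i j (Ne.symm h)) (hx.1 j)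
    have hs : (Y *ᵥ x) i = ∑ j, Y i j * x j := rfl
    have hs' := Finset.sum_nonpos hterm
    have := hInn i
    refine ⟨by linarith, fun j => ?_⟩
    exact (Finset.sum_eq_zero_iff_of_nonpos hterm).1 (by linarith) j (Finset.mem_univ _)
  refine ⟨x, ?_, ?_⟩
  · by_contra! hcon
    obtain ⟨i0, hi0⟩ := hcon
    have hi0' : x i0 = 0 := le_antisymm hi0 (hx.1 i0)
    by_cases hu : Finset.univ.filter (fun i => x i = 0) = Finset.univ
    · apply hIne
      ext i
      have : i ∈ Finset.univ.filter (fun i => x i = 0) := by rw [hu]; simp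
      exact (key i (by simpa using this)).1
    · obtain ⟨i, hi, j, hj, hij⟩ := hirr _ ⟨i0, by simpa using hi0'⟩ hu
      have h1 : x i = 0 := by simpa using hi
      have h2 : x j ≠ 0 := by simpa using hj
      exact (mul_ne_zero hij h2) ((key i h1).2 j)
  · ext i
    have := hz i
    rw [qf_Pc] at this
    linarith

lemma qf_abs {n : ℕ} {Y : Matrix (Fin n) (Fin n) ℝ} (hZ : IsZmat Y) {I : Fin n → ℝ}
    (hI : ∀ i, 0 ≤ I i) (P x : Fin n → ℝ) (t : ℝ) (i : Fin n) :
    qf Y I P (fun j => |x j|) (-|t|) i ≤ qf Y I P x t i := by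
  unfold qf
  have h1 : ∑ j, Y i j * (|x i| * |x j|) ≤ ∑ j, Y i j * (x i * x j) := by
    refine Finset.sum_le_sum fun j _ => ?_
    by_cases h : j = i
    · subst h; rw [abs_mul_abs_self]
    · rw [← abs_mul]
      exact mul_le_mul_of_nonpos_left (le_abs_self _) (hZ i j (Ne.symm h))
  have h2 : -|t| * (I i * |x i|) ≤ t * (I i * x i) := by
    have : -|t * x i| ≤ t * x i := neg_abs_le _
    rw [abs_mul] at this
    nlinarith [hI i, mul_le_mul_of_nonneg_left this (hI i)]
  have h3 : (-|t|) ^ 2 * P i = t ^ 2 * P i := by rw [neg_sq, sq_abs]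
  simp only
  linarith

lemma qf_convex {n : ℕ} {Y : Matrix (Fin n) (Fin n) ℝ} (hZ : IsZmat Y) {I : Fin n → ℝ}
    (hI : ∀ i, 0 ≤ I i) (P x y : Fin n → ℝ) (hx : ∀ i, 0 ≤ x i) (hy : ∀ i, 0 ≤ y i)
    (a b : ℝ) (ha : 0 ≤ a) (hb : 0 ≤ b) (hab : a + b = 1) (i : Fin n) :
    qf Y I P (fun j => √(a * x j ^ 2 + b * y j ^ 2)) (-1) i ≤
      a * qf Y I P x (-1) i + b * qf Y I P y (-1) i := by
  have hnn : ∀ j, 0 ≤ a * x j ^ 2 + b * y j ^ 2 := fun j => by positivity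
  have hij : ∀ j, a * (x i * x j) + b * (y i * y j) ≤
      √(a * x i ^ 2 + b * y i ^ 2) * √(a * x j ^ 2 + b * y j ^ 2) := by
    intro j
    rw [← Real.sqrt_mul (hnn i)]
    apply Real.le_sqrt_of_sq_le
    nlinarith [mul_nonneg (mul_nonneg ha hb) (sq_nonneg (x i * y j - x j * y i))]
  have hi : a * x i + b * y i ≤ √(a * x i ^ 2 + b * y i ^ 2) := by
    apply Real.le_sqrt_of_sq_le
    obtain rfl : b = 1 - a := by linarith
    nlinarith [mul_nonneg (mul_nonneg ha hb) (sq_nonneg (x i - y i))]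
  have h1 : ∑ j, Y i j * (√(a * x i ^ 2 + b * y i ^ 2) * √(a * x j ^ 2 + b * y j ^ 2)) ≤
      a * ∑ j, Y i j * (x i * x j) + b * ∑ j, Y i j * (y i * y j) := by
    rw [Finset.mul_sum, Finset.mul_sum, ← Finset.sum_add_distrib]
    refine Finset.sum_le_sum fun j _ => ?_
    by_cases h : j = i
    · subst h
      rw [Real.mul_self_sqrt (hnn j)]
      apply le_of_eq; ring
    · have := mul_le_mul_of_nonpos_left (hij j) (hZ i j (Ne.symm h))
      linarith
  have h2 := mul_le_mul_of_nonneg_left hi (hI i)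
  unfold qf
  obtain rfl : b = 1 - a := by linarith
  simp only
  linarith

lemma separation {n : ℕ} {Y : Matrix (Fin n) (Fin n) ℝ} (hPD : Y.PosDef)
    (hZ : IsZmat Y) (hirr : IsIrred Y) {I : Fin n → ℝ}
    (hI : ∀ i, 0 ≤ I i) (P : Fin n → ℝ)
    (hno : ¬ ∃ x : Fin n → ℝ, (∀ i, 0 ≤ x i) ∧ ∀ i, qf Y I P x (-1) i < 0) :
    ∃ ν : Fin n → ℝ, (∀ i, 0 < ν i) ∧ ∀ x t, 0 ≤ ∑ i, ν i * qf Y I P x t i := by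
  set G : Set (Fin n → ℝ) :=
    {w | ∃ x : Fin n → ℝ, (∀ i, 0 ≤ x i) ∧ ∀ i, qf Y I P x (-1) i < w i} with hG
  have hopen : IsOpen G := by
    have : G = ⋃ x : Fin n → ℝ, ⋃ _ : ∀ i, 0 ≤ x i, ⋂ i, {w | qf Y I P x (-1) i < w i} := by
      ext w; simp [hG]
    rw [this]
    exact isOpen_iUnion fun x => isOpen_iUnion fun _ => isOpen_iInter_of_finite fun i =>
      isOpen_lt continuous_const (continuous_apply i)
  have hconv : Convex ℝ G := by
    rintro u ⟨x, hx, hxu⟩ v ⟨y, hy, hyv⟩ a b ha hb hab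
    refine ⟨_, fun i => Real.sqrt_nonneg _, fun i =>
      (qf_convex hZ hI P x y hx hy a b ha hb hab i).trans_lt ?_⟩
    simp only [Pi.add_apply, Pi.smul_apply, smul_eq_mul]
    rcases ha.eq_or_lt with rfl | ha'
    · have : b = 1 := by linarith
      subst this
      simpa using hyv i
    · have := mul_lt_mul_of_pos_left (hxu i) ha'
      have := mul_le_mul_of_nonneg_left (hyv i).le hb
      linarith
  have h0 : (0 : Fin n → ℝ) ∉ G := fun ⟨x, hx, h⟩ => hno ⟨x, hx, by simpa using h⟩
  obtain ⟨φ, hφ⟩ := geometric_hahn_banach_open_point hconv hopen h0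
  set ν : Fin n → ℝ := fun i => -φ (Pi.single i 1) with hν
  have hφν : ∀ w, φ w = -∑ i, ν i * w i := by
    intro w
    conv_lhs => rw [pi_eq_sum_univ' w]
    rw [map_sum, ← Finset.sum_neg_distrib]
    refine Finset.sum_congr rfl fun i _ => ?_
    rw [map_smul, smul_eq_mul, hν]
    ring_nf
  have hpos : ∀ w ∈ G, 0 < ∑ i, ν i * w i := by
    intro w hw
    have := hφ w hw
    rw [map_zero, hφν] at this
    linarith
  have hq0 : ∀ i, qf Y I P 0 (-1) i = P i := by intro i; simp [qf]
  have hνnn : ∀ i, 0 ≤ ν i := by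
    intro i
    by_contra! hneg
    set C := ∑ k, ν k * (P k + 1) with hC
    have hs : ∀ s : ℝ, 0 ≤ s → 0 < C + s * ν i := by
      intro s hs
      have := hpos (fun k => P k + 1 + Pi.single (M := fun _ => ℝ) i s k) ⟨0, fun _ => le_rfl, fun k => by
        rw [hq0]
        have : 0 ≤ Pi.single (M := fun _ => ℝ) i s k := by
          rw [Pi.single_apply]; split_ifs <;> simp [hs]
        linarith⟩
      simp only [mul_add, Finset.sum_add_distrib] at this
      rw [hC]
      simp only [mul_add, Finset.sum_add_distrib]
      simpa [Pi.single_apply, mul_comm] using this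
    have h1 := hs (|C| / (-ν i)) (div_nonneg (abs_nonneg _) (by linarith))
    have h2 : |C| / (-ν i) * ν i = -|C| := by
      have := hneg.ne
      field_simp
    linarith [le_abs_self C]
  have hνne : ∃ i, ν i ≠ 0 := by
    by_contra! hall
    have := hpos (fun k => P k + 1) ⟨0, fun _ => le_rfl, fun k => by rw [hq0]; simp⟩
    simp [hall] at this
  have hge1 : ∀ x : Fin n → ℝ, (∀ i, 0 ≤ x i) → 0 ≤ ∑ i, ν i * qf Y I P x (-1) i := by
    intro x hx
    have := lim_nonneg (h := fun e => ∑ i, ν i * (qf Y I P x (-1) i + e)) (by fun_prop)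
      (fun e he => (hpos _ ⟨x, hx, fun i => by linarith⟩).le)
    simpa using this
  have hge2 : ∀ (x : Fin n → ℝ) (t : ℝ), t ≠ 0 → 0 ≤ ∑ i, ν i * qf Y I P x t i := by
    intro x t ht
    have ht' : 0 < |t| := abs_pos.2 ht
    have h1 := hge1 (|t|⁻¹ • fun j => |x j|) (fun i => by
      simp only [Pi.smul_apply, smul_eq_mul]; positivity)
    have h2 : ∀ i, qf Y I P (|t|⁻¹ • fun j => |x j|) (-1) i =
        (|t|⁻¹) ^ 2 * qf Y I P (fun j => |x j|) (-|t|) i := by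
      intro i
      rw [← qf_smul]
      congr 1
      field_simp
    have h3 : 0 ≤ ∑ i, ν i * qf Y I P (fun j => |x j|) (-|t|) i := by
      have h4 : ∑ i, ν i * qf Y I P (|t|⁻¹ • fun j => |x j|) (-1) i =
          (|t|⁻¹) ^ 2 * ∑ i, ν i * qf Y I P (fun j => |x j|) (-|t|) i := by
        rw [Finset.mul_sum]
        refine Finset.sum_congr rfl fun i _ => ?_
        rw [h2]; ring
      rw [h4] at h1
      exact nonneg_of_mul_nonneg_right h1 (by positivity)
    exact h3.trans (Finset.sum_le_sum fun i _ =>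
      mul_le_mul_of_nonneg_left (qf_abs hZ hI P x t i) (hνnn i))
  have hge : ∀ (x : Fin n → ℝ) (t : ℝ), 0 ≤ ∑ i, ν i * qf Y I P x t i := by
    intro x t
    by_cases ht : t = 0
    · subst ht
      exact lim_nonneg (h := fun e => ∑ i, ν i * qf Y I P x e i)
        (continuous_finsetSum _ fun i _ => continuous_const.mul
          ((qf_cont Y I P i).comp (continuous_const.prodMk continuous_id)))
        (fun e he => hge2 x e he.ne')
    · exact hge2 x t ht
  refine ⟨ν, ?_, hge⟩
  by_contra! hcon
  obtain ⟨i0, hi0⟩ := hcon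
  have hi0' : ν i0 = 0 := le_antisymm hi0 (hνnn i0)
  obtain ⟨k, hk⟩ := hνne
  obtain ⟨i, hi, j, hj, hij⟩ := hirr (Finset.univ.filter (fun i => ν i = 0))
    ⟨i0, by simpa using hi0'⟩ (fun h => hk (by
      have : k ∈ Finset.univ.filter (fun i => ν i = 0) := by rw [h]; simp
      simpa using this))
  have hi' : ν i = 0 := by simpa using hi
  have hj' : ν j ≠ 0 := by simpa using hj
  have hne : i ≠ j := by rintro rfl; exact hj' hi'
  rw [pd_symm hPD] at hij
  set s : ℝ := -(Y j j + 1) / Y j i with hs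
  have := hge (Pi.single i s + Pi.single j 1) 0
  have hq : ∀ u : Fin n → ℝ, ∀ l, qf Y I P u 0 l = u l * (Y *ᵥ u) l := by
    intro u l
    simp only [qf, Matrix.mulVec, dotProduct, Finset.mul_sum]
    simp only [zero_mul, add_zero, ne_eq, OfNat.ofNat_ne_zero, not_false_eq_true, zero_pow]
    exact Finset.sum_congr rfl fun j _ => by ring
  rw [Finset.sum_eq_single j] at this
  · rw [hq, Matrix.mulVec_add] at this
    simp [hne.symm] at this
    have h5 : Y j i * s = -(Y j j + 1) := by rw [hs]; field_simp
    have h6 : 0 < ν j := lt_of_le_of_ne (hνnn j) (Ne.symm hj')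
    nlinarith
  · intro l _ hl
    by_cases hli : l = i
    · rw [hli, hi', zero_mul]
    · rw [hq]; simp [hl, hli]
  · simp

lemma S_empty {n : ℕ} (hn : 1 ≤ n) {Y : Matrix (Fin n) (Fin n) ℝ} (hPD : Y.PosDef)
    (Vs P : Fin n → ℝ) (h : ∀ e : ℝ, 0 < e → (Sset Y (Y *ᵥ Vs) (fun i => P i - e)).Nonempty) :
    (Sset Y (Y *ᵥ Vs) P).Nonempty := by
  have hq : ∀ x e i, qf Y (Y *ᵥ Vs) (fun i => P i - e) x (-1) i =
      qf Y (Y *ᵥ Vs) P x (-1) i - e := by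
    intro x e i; simp only [qf]; ring
  obtain ⟨x, hx⟩ := IsCompact.nonempty_iInter_of_sequence_nonempty_isCompact_isClosed
    (fun k : ℕ => Sset Y (Y *ᵥ Vs) (fun i => P i - 1 / ((k : ℝ) + 1)))
    (fun k x hx => ⟨hx.1, fun i => by
      have h1 := hx.2 i
      rw [hq] at h1 ⊢
      have h2 : 1 / (((k + 1 : ℕ) : ℝ) + 1) ≤ 1 / ((k : ℝ) + 1) := by
        push_cast
        apply one_div_le_one_div_of_le <;> [positivity; linarith]
      linarith⟩)
    (fun k => h _ (by positivity)) (Sset_compact hn hPD _ _) (fun k => Sset_closed _ _ _)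
  rw [Set.mem_iInter] at hx
  refine ⟨x, (hx 0).1, fun i => ?_⟩
  refine ge_of_tendsto' tendsto_one_div_add_atTop_nhds_zero_nat (fun k => ?_)
  have h1 := (hx k).2 i
  rw [hq] at h1
  linarith

theorem stmt_19 (n : ℕ) (hn : 1 ≤ n)
    (Y : Matrix (Fin n) (Fin n) ℝ)
    (hPD : Y.PosDef)
    (hZ : IsZmat Y)
    (hirr : IsIrred Y)
    (Vs : Fin n → ℝ) (hVs : ∀ i, 0 < Vs i)
    (hInn : ∀ i, 0 ≤ (Y *ᵥ Vs) i) (hIne : Y *ᵥ Vs ≠ 0)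
    (Pt : Fin n → ℝ) :
    (Pt ∈ Fset Y Vs ↔ ¬ ∃ ν : Fin n → ℝ, (∀ i, 0 < ν i) ∧ (Mnu Y Vs Pt ν).PosDef) ∧
    (Pt ∈ interior (Fset Y Vs) ↔
      ¬ ∃ ν : Fin n → ℝ, (∀ i, 0 < ν i) ∧ (Mnu Y Vs Pt ν).PosSemidef) := by
  have hsum : ∀ ν : Fin n → ℝ, (∀ i, 0 < ν i) → 0 < ∑ i, ν i := fun ν hν =>
    Finset.sum_pos (fun i _ => hν i) ⟨⟨0, hn⟩, Finset.mem_univ _⟩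
  have hsol := exists_sol hn hPD hZ hirr Vs hInn hIne
  constructor
  · constructor
    · rintro ⟨x, hx, hP⟩ ⟨ν, hν, hM⟩
      have hne : Sum.elim x (fun _ : Fin 1 => (-1 : ℝ)) ≠ 0 := by
        intro h
        have := congrFun h (Sum.inr 0)
        simp at this
      have := hM.dotProduct_mulVec_pos hne
      rw [Mnu_quad hPD] at this
      simp [qf_Pc, hP] at this
    · intro hno
      by_contra hF
      apply hno
      have hSe : ¬ (Sset Y (Y *ᵥ Vs) Pt).Nonempty := fun h => hF (hsol Pt h)
      have := mt (S_empty hn hPD Vs Pt) hSe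
      push Not at this
      obtain ⟨e, he, hemp⟩ := this
      obtain ⟨ν, hν, hge⟩ := separation hPD hZ hirr hInn (fun i => Pt i - e) (by
        rintro ⟨x, hx, hlt⟩
        have : x ∈ Sset Y (Y *ᵥ Vs) (fun i => Pt i - e) := ⟨hx, fun i => (hlt i).le⟩
        simp [hemp] at this)
      have hs := hsum ν hν
      set K := ∑ i, Pt i - (Vs ⬝ᵥ (Y *ᵥ Vs)) / 4 with hK
      set η := e * (∑ i, ν i) / (|K| + 1) with hη
      have hηpos : 0 < η := by positivity
      have hη2 : η * (|K| + 1) = e * ∑ i, ν i := by rw [hη]; field_simp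
      have hcoef : 0 < e * (∑ i, ν i) + η * K := by
        nlinarith [neg_abs_le K]
      refine ⟨fun i => ν i + η, fun i => add_pos (hν i) hηpos,
        Matrix.PosDef.of_dotProduct_mulVec_pos (Mnu_herm hPD _ _ _) fun z hz => ?_⟩
      rw [Mnu_quad hPD]
      generalize hxe : z ∘ Sum.inl = x
      generalize hte : z (Sum.inr 0) = t
      have hsplit : ∑ i, (ν i + η) * qf Y (Y *ᵥ Vs) Pt x t i =
          ∑ i, ν i * qf Y (Y *ᵥ Vs) (fun i => Pt i - e) x t i + t ^ 2 * (e * ∑ i, ν i) +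
            η * ∑ i, qf Y (Y *ᵥ Vs) Pt x t i := by
        rw [Finset.mul_sum, Finset.mul_sum, Finset.mul_sum, ← Finset.sum_add_distrib,
          ← Finset.sum_add_distrib]
        refine Finset.sum_congr rfl fun i _ => ?_
        simp only [qf]; ring
      rw [hsplit, sum_qf hPD, ← hK]
      have h1 := hge x t
      have h2 : ∀ y : Fin n → ℝ, 0 ≤ y ⬝ᵥ (Y *ᵥ y) := fun y => by
        simpa using hPD.posSemidef.dotProduct_mulVec_nonneg y
      by_cases ht : t = 0
      · have hx : x ≠ 0 := by
          rintro rfl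
          apply hz
          ext i
          rcases i with i | i
          · exact congrFun hxe i
          · rw [Subsingleton.elim i 0, hte, ht]; rfl
        have h3 : 0 < x ⬝ᵥ (Y *ᵥ x) := by simpa using hPD.dotProduct_mulVec_pos hx
        have h4 := mul_pos hηpos h3
        subst ht
        simp only [zero_div, zero_smul, add_zero, ne_eq, OfNat.ofNat_ne_zero, not_false_eq_true,
          zero_pow, zero_mul]
        linarith
      · have h3 := mul_nonneg hηpos.le (h2 (x + (t / 2) • Vs))
        have h4 := mul_pos (pow_pos (abs_pos.2 ht) 2) hcoef
        rw [sq_abs] at h4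
        linarith
  · constructor
    · rintro hint ⟨ν, hν, hM⟩
      have hev : ∀ᶠ e : ℝ in nhdsWithin 0 (Set.Ioi 0), (fun i => Pt i + e) ∈ Fset Y Vs := by
        have hc : Continuous fun e : ℝ => (fun i => Pt i + e : Fin n → ℝ) := by fun_prop
        have hc0 := hc.continuousWithinAt (s := Set.Ioi 0) (x := 0)
        apply hc0
        simpa using mem_interior_iff_mem_nhds.1 hint
      obtain ⟨e, ⟨x, hx, hP⟩, he⟩ := (hev.and self_mem_nhdsWithin).exists
      have he' : 0 < e := he
      have := hM.dotProduct_mulVec_nonneg (Sum.elim x (fun _ : Fin 1 => (-1 : ℝ)))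
      rw [Mnu_quad hPD] at this
      simp only [Sum.elim_comp_inl, Sum.elim_inr, qf_Pc, hP, sub_add_cancel_left, mul_neg,
        Finset.sum_neg_distrib, ← Finset.sum_mul] at this
      have := mul_pos (hsum ν hν) he'
      linarith
    · intro hno
      by_contra hF
      apply hno
      obtain ⟨ν, hν, hge⟩ := separation hPD hZ hirr hInn Pt (by
        rintro ⟨x, hx, hlt⟩
        apply hF
        rw [mem_interior]
        refine ⟨⋂ i, {P' | P' i < Pc Y Vs x i}, fun P' hP' => ?_,
          isOpen_iInter_of_finite fun i => isOpen_lt (continuous_apply i) continuous_const, ?_⟩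
        · rw [Set.mem_iInter] at hP'
          refine hsol P' ⟨x, hx, fun i => ?_⟩
          have : P' i < Pc Y Vs x i := hP' i
          rw [qf_Pc]; linarith
        · rw [Set.mem_iInter]
          intro i
          have := hlt i
          rw [qf_Pc] at this
          show Pt i < Pc Y Vs x i
          linarith)
      refine ⟨ν, hν, Matrix.PosSemidef.of_dotProduct_mulVec_nonneg (Mnu_herm hPD _ _ _)
        fun z => ?_⟩
      rw [Mnu_quad hPD]
      have := hge (z ∘ Sum.inl) (z (Sum.inr 0))
      linarith
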